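/- Let b(n) denote the number of partition triples π = (π₁, π₂, π₃) of n such that π₁ consists of distinct odd parts, and π₂ and π₃ consist of parts divisible by 4 (with b(0) = 1). Then for all integers n ≥ 0 and k ≥ 0, b(3^{2(k+1)} n + (5·3^{2(k+1)} + 3)/8) ≡ (−1)^k · b(9n + 6) (mod 3). -/

import Mathlib

open PowerSeries

/-- `bTriple n` is the number of partition triples `(π₁, π₂, π₃)` of `n` such that
`π₁` has distinct odd parts and all parts of `π₂` and `π₃` are (positive and)
divisible by `4`. -/
noncomputable def bTriple (n : ℕ) : ℕ :=
  Nat.card {t : Multiset ℕ × Multiset ℕ × Multiset ℕ //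
    t.1.sum + t.2.1.sum + t.2.2.sum = n ∧
    t.1.Nodup ∧ (∀ x ∈ t.1, Odd x) ∧
    (∀ x ∈ t.2.1, 0 < x ∧ 4 ∣ x) ∧
    (∀ x ∈ t.2.2, 0 < x ∧ 4 ∣ x)}


namespace BT

open scoped PowerSeries.WithPiTopology

abbrev S := PowerSeries (ZMod 3)

instance : CharP S 3 :=
  charP_of_injective_ringHom (f := (C : ZMod 3 →+* S)) PowerSeries.C_injective 3

/-- infinite product of `1 + ε X^(m k + a)` -/
noncomputable def P (ε : ZMod 3) (a m : ℕ) : S := ∏' k : ℕ, (1 + C ε * X ^ (m * k + a))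

theorem mult (ε : ZMod 3) (a m : ℕ) (hm : 0 < m) :
    Multipliable (fun k : ℕ => (1 + C ε * X ^ (m * k + a) : S)) := by
  apply WithPiTopology.multipliable_one_add_of_tendsto_order_atTop_nhds_top
  refine ENat.tendsto_nhds_top_iff_natCast_lt.mpr (fun n ↦ Filter.eventually_atTop.mpr ⟨n+1, ?_⟩)
  intro k hk
  grw [← le_order_mul]
  refine lt_add_of_nonneg_of_lt (by simp) ?_
  rw [order_X_pow]
  norm_cast
  nlinarith

theorem P_split2 (ε : ZMod 3) (a m : ℕ) (hm : 0 < m) :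
    P ε a (2*m) * P ε (a+m) (2*m) = P ε a m := by
  unfold P
  have := tprod_even_mul_odd (f := fun k : ℕ => (1 + C ε * X ^ (m * k + a) : S)) ?_ ?_
  · rw [← this]
    congr 2 <;> · funext k; congr 3; ring
  · convert mult ε a (2*m) (by omega) using 5; ring
  · convert mult ε (a+m) (2*m) (by omega) using 5; ring

theorem hasProd_mod3 {f : ℕ → S} {a b c : S} (h0 : HasProd (fun k => f (3*k)) a)
    (h1 : HasProd (fun k => f (3*k+1)) b) (h2 : HasProd (fun k => f (3*k+2)) c) :
    HasProd f (a*b*c) := by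
  have i0 : Function.Injective (fun k : ℕ => 3*k) := fun x y h => by simpa using h
  have i1 : Function.Injective (fun k : ℕ => 3*k+1) := fun x y h => by simpa using h
  have i2 : Function.Injective (fun k : ℕ => 3*k+2) := fun x y h => by simpa using h
  have H0 := i0.hasProd_range_iff.2 h0
  have H1 := i1.hasProd_range_iff.2 h1
  have H2 := i2.hasProd_range_iff.2 h2
  have H01 := H0.mul_disjoint (by
    rw [Set.disjoint_left]; rintro x ⟨y, rfl⟩ ⟨z, hz⟩; simp at hz; omega) H1
  refine H01.mul_isCompl ?_ H2
  rw [isCompl_iff, codisjoint_iff, Set.disjoint_left]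
  constructor
  · rintro x (⟨y, rfl⟩ | ⟨y, rfl⟩) ⟨z, hz⟩ <;> simp at hz <;> omega
  · ext x
    simp only [Set.sup_eq_union, Set.mem_union, Set.mem_range, Set.top_eq_univ, Set.mem_univ, iff_true]
    have : x % 3 = 0 ∨ x % 3 = 1 ∨ x % 3 = 2 := by omega
    rcases this with h | h | h
    · exact Or.inl (Or.inl ⟨x/3, by omega⟩)
    · exact Or.inl (Or.inr ⟨x/3, by omega⟩)
    · exact Or.inr ⟨x/3, by omega⟩

theorem hasSum_mod3 {f : ℤ → S} {a b c : S} (h0 : HasSum (fun k => f (3*k)) a)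
    (h1 : HasSum (fun k => f (3*k+1)) b) (h2 : HasSum (fun k => f (3*k+2)) c) :
    HasSum f (a+b+c) := by
  have i0 : Function.Injective (fun k : ℤ => 3*k) := fun x y h => by simpa using h
  have i1 : Function.Injective (fun k : ℤ => 3*k+1) := fun x y h => by simpa using h
  have i2 : Function.Injective (fun k : ℤ => 3*k+2) := fun x y h => by simpa using h
  have H0 := i0.hasSum_range_iff.2 h0
  have H1 := i1.hasSum_range_iff.2 h1
  have H2 := i2.hasSum_range_iff.2 h2
  have H01 := H0.add_disjoint (by
    rw [Set.disjoint_left]; rintro x ⟨y, rfl⟩ ⟨z, hz⟩; simp at hz; omega) H1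
  refine H01.add_isCompl ?_ H2
  rw [isCompl_iff, codisjoint_iff, Set.disjoint_left]
  constructor
  · rintro x (⟨y, rfl⟩ | ⟨y, rfl⟩) ⟨z, hz⟩ <;> simp at hz <;> omega
  · ext x
    simp only [Set.sup_eq_union, Set.mem_union, Set.mem_range, Set.top_eq_univ, Set.mem_univ, iff_true]
    have : x % 3 = 0 ∨ x % 3 = 1 ∨ x % 3 = 2 := by omega
    rcases this with h | h | h
    · exact Or.inl (Or.inl ⟨x/3, by omega⟩)
    · exact Or.inl (Or.inr ⟨x/3, by omega⟩)
    · exact Or.inr ⟨x/3, by omega⟩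

theorem hasSum_mod2 {f : ℤ → S} {a b : S} (h0 : HasSum (fun k => f (2*k)) a)
    (h1 : HasSum (fun k => f (2*k+1)) b) :
    HasSum f (a+b) := by
  have i0 : Function.Injective (fun k : ℤ => 2*k) := fun x y h => by simpa using h
  have i1 : Function.Injective (fun k : ℤ => 2*k+1) := fun x y h => by simpa using h
  have H0 := i0.hasSum_range_iff.2 h0
  have H1 := i1.hasSum_range_iff.2 h1
  refine H0.add_isCompl ?_ H1
  rw [isCompl_iff, codisjoint_iff, Set.disjoint_left]
  constructor
  · rintro x ⟨y, rfl⟩ ⟨z, hz⟩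
    simp at hz; omega
  · ext x
    simp only [Set.sup_eq_union, Set.mem_union, Set.mem_range, Set.top_eq_univ, Set.mem_univ, iff_true]
    have : x % 2 = 0 ∨ x % 2 = 1 := by omega
    rcases this with h | h
    · exact (Or.inl ⟨x/2, by omega⟩)
    · exact Or.inr ⟨x/2, by omega⟩

theorem P_split3 (ε : ZMod 3) (a m : ℕ) (hm : 0 < m) :
    P ε a (3*m) * P ε (a+m) (3*m) * P ε (a+2*m) (3*m) = P ε a m := by
  symm
  apply HasProd.tprod_eq
  apply hasProd_mod3
  · have := (mult ε a (3*m) (by omega)).hasProd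
    change HasProd _ (P ε a (3*m)) at this
    convert this using 5; ring
  · have := (mult ε (a+m) (3*m) (by omega)).hasProd
    change HasProd _ (P ε (a+m) (3*m)) at this
    convert this using 5; ring
  · have := (mult ε (a+2*m) (3*m) (by omega)).hasProd
    change HasProd _ (P ε (a+2*m) (3*m)) at this
    convert this using 5; ring

theorem P_mul_neg (a m : ℕ) (hm : 0 < m) :
    P 1 a m * P (-1) a m = P (-1) (2*a) (2*m) := by
  unfold P
  rw [← (mult 1 a m hm).tprod_mul (mult (-1) a m hm)]
  congr 1; funext k
  have : 2 * m * k + 2 * a = (m*k+a) + (m*k+a) := by ring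
  rw [this, pow_add]
  simp
  ring

theorem P_cube (ε : ZMod 3) (a m : ℕ) (hm : 0 < m) :
    P ε a m ^ 3 = P ε (3*a) (3*m) := by
  unfold P
  rw [← (mult ε a m hm).tprod_pow]
  congr 1; funext k
  rw [add_pow_char, mul_pow, ← map_pow, ZMod.pow_card, ← pow_mul]
  have : (m * k + a) * 3 = 3 * m * k + 3 * a := by ring
  rw [this]; simp

theorem P_constCoeff (ε : ZMod 3) (a m : ℕ) (ha : 0 < a) (hm : 0 < m) :
    constantCoeff (P ε a m) = 1 := by
  unfold P
  rw [(mult ε a m hm).map_tprod (constantCoeff : S →+* ZMod 3) (WithPiTopology.continuous_constantCoeff _)]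
  simp [ha.ne']

theorem P_ne_zero (ε : ZMod 3) (a m : ℕ) (ha : 0 < a) (hm : 0 < m) : P ε a m ≠ 0 := by
  intro h
  have := P_constCoeff ε a m ha hm
  simp [h] at this

theorem expand_cube (f : S) : expand 3 (by norm_num) f = f ^ 3 := by
  ext n
  have h1 : f = ((trunc (n+1) f : Polynomial (ZMod 3)) : S) + X^(n+1) * PowerSeries.mk (fun i => coeff (i+(n+1)) f) := by
    rw [add_comm, ← eq_X_pow_mul_shift_add_trunc]
  have h2 : f^3 = (((trunc (n+1) f)^3 : Polynomial (ZMod 3)) : S) + X^(n+1) * (X^(2*n+2) * PowerSeries.mk (fun i => coeff (i+(n+1)) f)^3) := by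
    conv_lhs => rw [h1]
    rw [add_pow_char, mul_pow]
    push_cast; ring
  rw [h2, map_add, coeff_X_pow_mul', if_neg (by omega), add_zero, Polynomial.coeff_coe, ← ZMod.expand_card,
    Polynomial.coeff_expand (by norm_num), coeff_expand]
  split_ifs with h
  · rw [coeff_trunc, if_pos (by have := Nat.div_le_self n 3; omega)]
  · rfl

end BT


namespace BT

open scoped PowerSeries.WithPiTopology

/-- q-binomial coefficient `[i+j choose j]`. -/
def H {R : Type*} [CommRing R] (q : R) : ℕ → ℕ → R
  | 0, _ => 1
  | _ + 1, 0 => 1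
  | i + 1, j + 1 => H q i (j+1) + q^(i+1) * H q (i+1) j
termination_by i j => i + j

theorem H_zero_right {R : Type*} [CommRing R] (q : R) (i : ℕ) : H q i 0 = 1 := by
  cases i <;> simp [H]

/-- finite q-Pochhammer -/
def Q {R : Type*} [CommRing R] (q : R) (n : ℕ) : R := ∏ k ∈ Finset.range n, (1 - q^(k+1))

theorem H_mul {R : Type*} [CommRing R] (q : R) : ∀ i j, H q i j * Q q i * Q q j = Q q (i+j)
  | 0, j => by simp [H, Q]
  | i + 1, 0 => by simp [H, Q]
  | i + 1, j + 1 => by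
    have h1 := H_mul q i (j+1)
    have h2 := H_mul q (i+1) j
    have e1 : Q q (i+1) = Q q i * (1 - q^(i+1)) := Finset.prod_range_succ _ _
    have e2 : Q q (j+1) = Q q j * (1 - q^(j+1)) := Finset.prod_range_succ _ _
    have e3 : Q q (i+1+(j+1)) = Q q (i+j+1) * (1 - q^(i+j+1+1)) := by
      rw [show i+1+(j+1) = i+j+1+1 by ring]; exact Finset.prod_range_succ _ _
    rw [show i + (j+1) = i+j+1 by ring] at h1
    rw [show i + 1 + j = i+j+1 by ring] at h2
    rw [e3, H]
    calc (H q i (j+1) + q^(i+1) * H q (i+1) j) * Q q (i+1) * Q q (j+1)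
        = (H q i (j+1) * Q q i * Q q (j+1)) * (1 - q^(i+1))
          + q^(i+1) * (1 - q^(j+1)) * (H q (i+1) j * Q q (i+1) * Q q j) := by
          rw [e1, e2]; ring
      _ = _ := by rw [h1, h2]; ring
termination_by i j => i + j

theorem rothe {R : Type*} [CommRing R] (q Y T : R) (n : ℕ) :
    ∏ k ∈ Finset.range n, (Y + T * q^k) =
      ∑ p ∈ Finset.HasAntidiagonal.antidiagonal n, q^(p.2.choose 2) * H q p.1 p.2 * T^p.2 * Y^p.1 := by
  induction n with
  | zero => simp [H]
  | succ n ih =>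
    rw [Finset.prod_range_succ, ih]
    let F : ℕ → ℕ → R := fun i j => q^(j.choose 2) * H q i j * T^j * Y^i
    let A : ℕ × ℕ → R := fun p => match p with
      | (0, _) => 0
      | (i+1, j) => Y * F i j
    let B : ℕ × ℕ → R := fun p => match p with
      | (_, 0) => 0
      | (i, j+1) => T * q^(i+j) * F i j
    have key : ∀ p : ℕ × ℕ, p ∈ Finset.HasAntidiagonal.antidiagonal (n+1) → F p.1 p.2 = A p + B p := by
      rintro ⟨i, j⟩ hp
      rw [Finset.HasAntidiagonal.mem_antidiagonal] at hp
      have hch : ∀ j, (j+1).choose 2 = j + j.choose 2 := fun j => by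
        rw [Nat.choose_succ_succ]; simp
      match i, j with
      | 0, 0 => simp at hp
      | 0, j+1 => simp only [F, A, B, H, hch]; ring
      | i+1, 0 => simp only [F, A, B, H, H_zero_right]; simp; ring
      | i+1, j+1 =>
        simp only [F, A, B, H, hch]; ring
    change (∑ p ∈ Finset.HasAntidiagonal.antidiagonal n, F p.1 p.2) * _ = ∑ p ∈ Finset.HasAntidiagonal.antidiagonal (n+1), F p.1 p.2
    rw [Finset.sum_congr rfl key, Finset.sum_add_distrib, Finset.Nat.sum_antidiagonal_succ,
      Finset.Nat.sum_antidiagonal_succ', mul_add, Finset.sum_mul, Finset.sum_mul]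
    simp only [A, B, zero_add]
    congr 1
    · exact Finset.sum_congr rfl fun p _ => by ring
    · refine Finset.sum_congr rfl fun p hp => ?_
      rw [Finset.HasAntidiagonal.mem_antidiagonal] at hp
      rw [hp]; ring

/-- triangular numbers -/
def tri (s : ℤ) : ℕ := (s * (s+1) / 2).toNat

theorem two_tri (s : ℤ) : (2 * tri s : ℤ) = s * (s+1) := by
  have h : 0 ≤ s * (s+1) := by
    rcases le_or_gt 0 s with h | h
    · positivity
    · nlinarith
  have h2 : 2 ∣ s * (s+1) := (Int.even_mul_succ_self s).two_dvd
  unfold tri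
  rw [Int.toNat_of_nonneg (by omega)]
  omega

/-- theta exponent -/
def ex (a b : ℕ) (s : ℤ) : ℕ := a * tri s + b * tri (-s)

theorem two_ex (a b : ℕ) (s : ℤ) : (2 * ex a b s : ℤ) = a * (s * (s+1)) + b * (s * (s-1)) := by
  have h1 := two_tri s
  have h2 := two_tri (-s)
  unfold ex; push_cast
  linear_combination a * h1 + b * h2

theorem le_ex (a b : ℕ) (ha : 0 < a) (hb : 0 < b) (s : ℤ) : s.natAbs ≤ ex a b s := by
  have h1 := two_tri s
  have h2 := two_tri (-s)
  have h3 : ((s.natAbs : ℤ)) ≤ s * s := by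
    have := Int.natAbs_le_self_sq s
    rw [sq] at this; exact this
  have h4 : tri s + tri (-s) ≤ ex a b s := by unfold ex; nlinarith
  have h5 : ((tri s + tri (-s) : ℕ) : ℤ) = s * s := by push_cast; linarith
  zify at h4 ⊢; push_cast at h5
  simp only [Int.natCast_natAbs] at h3
  linarith

noncomputable def Th (ε : ZMod 3) (a b : ℕ) : S :=
  PowerSeries.mk fun n => ∑ s ∈ Finset.Icc (-(n:ℤ)) n, if ex a b s = n then ε ^ s.natAbs else 0

theorem hasSum_Th (ε : ZMod 3) (a b : ℕ) (ha : 0 < a) (hb : 0 < b) :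
    HasSum (fun s : ℤ => (C (ε ^ s.natAbs) * X ^ (ex a b s) : S)) (Th ε a b) := by
  rw [WithPiTopology.hasSum_iff_hasSum_coeff]
  intro d
  rw [Th, coeff_mk]
  have : ∀ s : ℤ, coeff d (C (ε ^ s.natAbs) * X ^ (ex a b s) : S) = if ex a b s = d then ε ^ s.natAbs else 0 := by
    intro s
    rw [coeff_C_mul, coeff_X_pow]
    simp [eq_comm]
  simp_rw [this]
  apply hasSum_sum_of_ne_finset_zero
  intro s hs
  rw [if_neg]
  rintro h
  have := le_ex a b ha hb s
  apply hs
  rw [Finset.mem_Icc]; omega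

theorem Th_coeff_of_le (ε : ZMod 3) (a b : ℕ) (ha : 0 < a) (hb : 0 < b) (d N : ℕ) (h : d ≤ N) :
    coeff d (Th ε a b) = ∑ s ∈ Finset.Icc (-(N:ℤ)) N, if ex a b s = d then ε ^ s.natAbs else 0 := by
  rw [Th, coeff_mk]
  apply Finset.sum_subset
  · intro s; simp only [Finset.mem_Icc]; omega
  · intro s _ hs
    rw [if_neg]
    rintro h
    have := le_ex a b ha hb s
    apply hs
    rw [Finset.mem_Icc]; omega

noncomputable def PN (ε : ZMod 3) (a m N : ℕ) : S := ∏ k ∈ Finset.range N, (1 + C ε * X ^ (m * k + a))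

theorem tendsto_PN (ε : ZMod 3) (a m : ℕ) (hm : 0 < m) :
    Filter.Tendsto (PN ε a m) Filter.atTop (nhds (P ε a m)) :=
  (mult ε a m hm).hasProd.tendsto_prod_nat

theorem finite_jtp (ε : ZMod 3) (hε : ε * ε = 1) (a b N : ℕ) (ha : 0 < a) (hb : 0 < b) :
    PN ε a (a+b) N * PN ε b (a+b) N =
      ∑ s ∈ Finset.Icc (-(N:ℤ)) N, C (ε ^ s.natAbs) * X ^ (ex a b s) *
        H (X^(a+b) : S) (N - s).toNat (N + s).toNat := by
  have hCε : (C ε * C ε : S) = 1 := by rw [← map_mul, hε, map_one]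
  set m := a + b with hm
  have h := rothe (X^m : S) (X^(m*N)) (C ε * X^a) (N+N)
  rw [Finset.prod_range_add] at h
  have h1 : ∏ k ∈ Finset.range N, ((X:S)^(m*N) + C ε * X^a * (X^m)^(N+k)) = (X^(m*N))^N * PN ε a m N := by
    have hc : ((X:S)^(m*N))^N = ∏ k ∈ Finset.range N, (X:S)^(m*N) := by simp
    rw [PN, hc, ← Finset.prod_mul_distrib]
    refine Finset.prod_congr rfl fun k _ => ?_
    ring
  have h2 : ∏ k ∈ Finset.range N, ((X:S)^(m*N) + C ε * X^a * (X^m)^k)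
      = (∏ k ∈ Finset.range N, (C ε * X^(a+m*k))) * PN ε b m N := by
    rw [PN, ← Finset.prod_range_reflect (fun k => 1 + C ε * X ^ (m * k + b)), ← Finset.prod_mul_distrib]
    refine Finset.prod_congr rfl fun k hk => ?_
    rw [Finset.mem_range] at hk
    obtain ⟨r, rfl⟩ : ∃ r, N = k + 1 + r := ⟨N - (k+1), by omega⟩
    have e : k + 1 + r - 1 - k = r := by omega
    rw [e]
    have e2 : m * (k+1+r) = (a + m*k) + (m * r + b) := by rw [hm]; ring
    rw [e2]
    linear_combination (-X^(a + m*k) * X^(m*r+b)) * hCε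
  have h3 : (∏ k ∈ Finset.range N, (C ε * (X:S)^(a+m*k))) = C (ε^N) * X^(a*N + m * N.choose 2) := by
    rw [Finset.prod_mul_distrib, Finset.prod_const, Finset.card_range, map_pow, Finset.prod_pow_eq_pow_sum,
      Finset.sum_add_distrib, ← Finset.mul_sum, Finset.sum_range_id, Nat.choose_two_right]
    simp [mul_comm]
  rw [h1, h2, h3] at h
  have hK : (C (ε^N) * X^(a*N + m*N.choose 2 + m*N*N) : S) ≠ 0 := by
    intro h0
    have := congrArg (coeff (a*N + m*N.choose 2 + m*N*N)) h0
    rw [coeff_C_mul_X_pow, if_pos rfl] at this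
    simp at this
    rw [this.1] at hε; simp at hε
  apply mul_left_cancel₀ hK
  have : (C (ε^N) * X^(a*N + m*N.choose 2 + m*N*N) : S) * (PN ε a m N * PN ε b m N)
    = C (ε ^ N) * X ^ (a * N + m * N.choose 2) * PN ε b m N * ((X ^ (m * N)) ^ N * PN ε a m N) := by
    rw [← pow_mul]; ring
  rw [this, h, Finset.mul_sum]
  symm
  refine Finset.sum_bij' (fun s _ => ((N - s).toNat, (N + s).toNat)) (fun p _ => (p.2 : ℤ) - N) ?_ ?_ ?_ ?_ ?_
  · intro s hs; rw [Finset.mem_Icc] at hs; rw [Finset.HasAntidiagonal.mem_antidiagonal]; simp only; omega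
  · intro p hp; rw [Finset.HasAntidiagonal.mem_antidiagonal] at hp; rw [Finset.mem_Icc]; omega
  · intro s hs; rw [Finset.mem_Icc] at hs; simp only; omega
  · rintro ⟨i, j⟩ hp; rw [Finset.HasAntidiagonal.mem_antidiagonal] at hp; simp only [Prod.mk.injEq] at hp ⊢; omega
  · intro s hs
    rw [Finset.mem_Icc] at hs
    obtain ⟨i, hi⟩ : ∃ i : ℕ, (N - s) = i := ⟨(N-s).toNat, by omega⟩
    obtain ⟨j, hj⟩ : ∃ j : ℕ, (N + s) = j := ⟨(N+s).toNat, by omega⟩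
    rw [hi, hj]
    simp only [Int.toNat_natCast]
    have e1 : a*N + m*N.choose 2 + m*N*N + ex a b s = m * j.choose 2 + a * j + m * N * i := by
      have t1 := two_ex a b s
      have t2 : (2 * N.choose 2 : ℤ) = N * (N - 1) := by
        rw [Nat.choose_two_right]
        have := Nat.div_mul_cancel (Nat.even_mul_pred_self N).two_dvd
        zify at this
        rcases N with _ | N
        · simp
        · push_cast at this ⊢; simp at this ⊢; linarith
      have t3 : (2 * j.choose 2 : ℤ) = j * (j - 1) := by
        rw [Nat.choose_two_right]
        have := Nat.div_mul_cancel (Nat.even_mul_pred_self j).two_dvd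
        zify at this
        rcases j with _ | N
        · simp
        · push_cast at this ⊢; simp at this ⊢; linarith
      zify
      have hm' : (m : ℤ) = a + b := by rw [hm]; push_cast; rfl
      have : (2:ℤ) * (a*N + m*N.choose 2 + m*N*N + ex a b s) = 2 * (m * j.choose 2 + a * j + m * N * i) := by
        have hj' : (j:ℤ) = N + s := hj.symm
        have hi' : (i:ℤ) = N - s := hi.symm
        have : (2:ℤ) * (a*N + m*N.choose 2 + m*N*N + ex a b s) = 2*a*N + m * (2*N.choose 2) + 2*m*N*N + 2 * ex a b s := by ring
        rw [this, t1, t2]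
        have : (2:ℤ) * (m * j.choose 2 + a * j + m * N * i) = m * (2*j.choose 2) + 2*a*j+2*m*N*i := by ring
        rw [this, t3, hi', hj', hm']
        ring
      linarith
    have e2 : (ε^N * ε^s.natAbs) = ε^j := by
      have hsq : ∀ k, ε^(2*k) = 1 := fun k => by rw [pow_mul, sq, hε, one_pow]
      rcases le_or_gt 0 s with h0 | h0
      · rw [← pow_add]; congr 1; omega
      · have : N = j + s.natAbs := by omega
        rw [this, pow_add, mul_assoc, ← pow_add, ← two_mul, hsq, mul_one]
    calc _ = C (ε^N * ε^s.natAbs) * (X:S)^(a*N + m*N.choose 2 + m*N*N + ex a b s) * H (X^m) i j := by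
            rw [map_mul, pow_add _ _ (ex a b s)]; ring
      _ = _ := by
        rw [e2, e1, map_pow, mul_pow]; ring

theorem dvd_Q (m : ℕ) (hm : 0 < m) (d N : ℕ) (h : d ≤ N) : (X:S)^(d+1) ∣ Q (X^m) N - Q (X^m) d := by
  induction N, h using Nat.le_induction with
  | base => simp
  | succ N hN ih =>
    have e1 : Q (X^m : S) (N+1) = Q (X^m) N * (1 - (X^m)^(N+1)) := Finset.prod_range_succ _ _
    have : Q (X^m : S) (N+1) - Q (X^m) d = (Q (X^m) N - Q (X^m) d) - Q (X^m) N * (X^m)^(N+1) := by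
      rw [e1]; ring
    rw [this]
    refine dvd_sub ih (Dvd.dvd.mul_left ?_ _)
    rw [← pow_mul]
    exact pow_dvd_pow _ (by nlinarith)

theorem PN_eq_Q (m N : ℕ) : PN (-1) m m N = Q (X^m) N := by
  unfold PN Q
  refine Finset.prod_congr rfl fun k _ => ?_
  rw [← pow_mul]; simp; ring

theorem dvd_P (m : ℕ) (hm : 0 < m) (d N : ℕ) (h : d ≤ N) : (X:S)^(d+1) ∣ P (-1) m m - Q (X^m) N := by
  rw [X_pow_dvd_iff]
  intro k hk
  have t := (WithPiTopology.tendsto_iff_coeff_tendsto _ _ _ _).1 (tendsto_PN (-1) m m hm) k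
  rw [nhds_discrete, Filter.tendsto_pure] at t
  obtain ⟨M, hM1, hM2⟩ := (t.and (Filter.eventually_ge_atTop N)).exists
  rw [PN_eq_Q] at hM1
  have h1 := X_pow_dvd_iff.1 (dvd_Q m hm d N h) k hk
  have h2 := X_pow_dvd_iff.1 (dvd_Q m hm d M (h.trans hM2)) k hk
  rw [map_sub, sub_eq_zero] at *
  rw [← hM1, h2, h1]

theorem dvd_H (m : ℕ) (hm : 0 < m) (d i j : ℕ) (hi : d ≤ i) (hj : d ≤ j) :
    (X:S)^(d+1) ∣ H (X^m) i j * P (-1) m m - 1 := by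
  set f := P (-1) m m
  have hu : IsUnit f := by
    rw [isUnit_iff_constantCoeff, P_constCoeff _ _ _ hm hm]; exact isUnit_one
  have h1 := dvd_P m hm d i hi
  have h2 := dvd_P m hm d j hj
  have h3 := dvd_P m hm d (i+j) (by omega)
  have h := H_mul (X^m : S) i j
  have e : (H (X^m) i j * f - 1) * f = H (X^m) i j * (f - Q (X^m) i) * f + H (X^m) i j * Q (X^m) i * (f - Q (X^m) j)
     - (f - Q (X^m) (i+j)) := by rw [← h]; ring
  rw [← hu.dvd_mul_right, e]
  exact dvd_sub (dvd_add ((h1.mul_left _).mul_right _) (h2.mul_left _)) h3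

theorem jtp (ε : ZMod 3) (hε : ε * ε = 1) (a b : ℕ) (ha : 0 < a) (hb : 0 < b) :
    P ε a (a+b) * P ε b (a+b) * P (-1) (a+b) (a+b) = Th ε a b := by
  ext d
  have hm : 0 < a + b := by omega
  have t := (((tendsto_PN ε a (a+b) hm).mul (tendsto_PN ε b (a+b) hm)).mul_const (P (-1) (a+b) (a+b)))
  have t := (WithPiTopology.tendsto_iff_coeff_tendsto _ _ _ _).1 t d
  rw [nhds_discrete, Filter.tendsto_pure] at t
  obtain ⟨N, hN1, hN2⟩ := (t.and (Filter.eventually_ge_atTop (2*d))).exists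
  rw [← hN1, finite_jtp ε hε a b N ha hb, Finset.sum_mul, map_sum,
    Th_coeff_of_le ε a b ha hb d N (by omega)]
  refine Finset.sum_congr rfl fun s hs => ?_
  rw [Finset.mem_Icc] at hs
  have hle := le_ex a b ha hb s
  rw [mul_assoc, mul_assoc, coeff_C_mul, coeff_X_pow_mul']
  by_cases h : ex a b s ≤ d
  · have := X_pow_dvd_iff.1 (dvd_H (a+b) hm d (N-s).toNat (N+s).toNat (by omega) (by omega)) (d - ex a b s) (by omega)
    rw [map_sub, sub_eq_zero] at this
    rw [if_pos h, this, coeff_one]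
    by_cases h' : ex a b s = d
    · simp [h']
    · rw [if_neg (by omega), if_neg h', mul_zero]
  · rw [if_neg h, if_neg (by omega), mul_zero]

end BT


namespace BT

open scoped PowerSeries.WithPiTopology

/-- `q ↦ q^3` -/
noncomputable def E : S →ₐ[ZMod 3] S := expand 3 (by norm_num)

theorem E_eq (f : S) : E f = f^3 := expand_cube f

theorem coeff_E (f : S) (n : ℕ) : coeff n (E f) = if 3 ∣ n then coeff (n/3) f else 0 := by
  unfold E; rw [coeff_expand]

/-- dissection operator -/
noncomputable def U (r : ℕ) (f : S) : S := PowerSeries.mk fun n => coeff (3*n+r) f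

theorem coeff_U (r : ℕ) (f : S) (n : ℕ) : coeff n (U r f) = coeff (3*n+r) f := by
  unfold U; rw [coeff_mk]

theorem decomp (f : S) : f = E (U 0 f) + X * E (U 1 f) + X^2 * E (U 2 f) := by
  ext n
  rw [← pow_one (X : S), map_add, map_add, coeff_X_pow_mul', ← pow_mul, coeff_X_pow_mul', coeff_E, coeff_E, coeff_E]
  simp only [coeff_U]
  have : n % 3 = 0 ∨ n % 3 = 1 ∨ n % 3 = 2 := by omega
  rcases this with h | h | h
  · obtain ⟨k, rfl⟩ : ∃ k, n = 3*k := ⟨n/3, by omega⟩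
    rw [if_pos (by omega), show 3 * (3*k/3)+0 = 3*k by omega]
    have : ¬ (3 ∣ 3*k-1 ∧ 1 ≤ 3*k) := by omega
    have : ¬ (3 ∣ 3*k-1*2 ∧ 1*2 ≤ 3*k) := by omega
    split_ifs <;> first | omega | simp
  · obtain ⟨k, rfl⟩ : ∃ k, n = 3*k+1 := ⟨n/3, by omega⟩
    rw [if_neg (by omega), if_pos (by omega), if_pos (by omega), show 3 * ((3*k+1-1)/3)+1 = 3*k+1 by omega]
    split_ifs <;> first | omega | simp
  · obtain ⟨k, rfl⟩ : ∃ k, n = 3*k+2 := ⟨n/3, by omega⟩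
    rw [if_neg (by omega), if_pos (by omega), if_neg (by omega), if_pos (by omega), if_pos (by omega), show 3 * ((3*k+2-1*2)/3)+2 = 3*k+2 by omega]
    simp

theorem U0 (a b c : S) : U 0 (E a + X * E b + X^2 * E c) = a := by
  ext n
  rw [coeff_U, ← pow_one (X : S), map_add, map_add, coeff_X_pow_mul', ← pow_mul, coeff_X_pow_mul', coeff_E, coeff_E, coeff_E]
  rw [if_pos (by omega), show (3 * n + 0)/3 = n by omega]
  split_ifs <;> first | omega | simp

theorem U1 (a b c : S) : U 1 (E a + X * E b + X^2 * E c) = b := by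
  ext n
  rw [coeff_U, ← pow_one (X : S), map_add, map_add, coeff_X_pow_mul', ← pow_mul, coeff_X_pow_mul', coeff_E, coeff_E, coeff_E]
  rw [if_neg (by omega), if_pos (by omega), if_pos (by omega), show (3 * n + 1-1)/3 = n by omega]
  split_ifs <;> first | omega | simp

theorem U2 (a b c : S) : U 2 (E a + X * E b + X^2 * E c) = c := by
  ext n
  rw [coeff_U, ← pow_one (X : S), map_add, map_add, coeff_X_pow_mul', ← pow_mul, coeff_X_pow_mul', coeff_E, coeff_E, coeff_E]
  rw [if_neg (by omega), if_pos (by omega), if_neg (by omega), if_pos (by omega), if_pos (by omega), show (3 * n + 2-1*2)/3 = n by omega]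
  simp

theorem E_mul_decomp (f g : S) : f * E g = E (U 0 f * g) + X * E (U 1 f * g) + X^2 * E (U 2 f * g) := by
  conv_lhs => rw [decomp f]
  simp only [map_mul]; ring

theorem U0_mul (f g : S) : U 0 (f * E g) = U 0 f * g := by rw [E_mul_decomp, U0]
theorem U1_mul (f g : S) : U 1 (f * E g) = U 1 f * g := by rw [E_mul_decomp, U1]
theorem U2_mul (f g : S) : U 2 (f * E g) = U 2 f * g := by rw [E_mul_decomp, U2]

theorem U_add (r : ℕ) (f g : S) : U r (f + g) = U r f + U r g := by
  ext n; simp [coeff_U]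

theorem hasSum_E {f : ℤ → S} {a : S} (h : HasSum f a) : HasSum (fun s => E (f s)) (E a) := by
  rw [WithPiTopology.hasSum_iff_hasSum_coeff] at *
  intro d
  simp only [coeff_E]
  split_ifs
  · exact h _
  · exact hasSum_zero

theorem hasSum_two {f : ℤ → S} {a b : S} (σ τ : ℤ → ℤ) (i0 : Function.Injective σ)
    (i1 : Function.Injective τ) (hd : ∀ x y, σ x ≠ τ y) (hc : ∀ z, (∃ x, σ x = z) ∨ (∃ x, τ x = z))
    (h0 : HasSum (fun k => f (σ k)) a)
    (h1 : HasSum (fun k => f (τ k)) b) :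
    HasSum f (a+b) := by
  have H0 := i0.hasSum_range_iff.2 h0
  have H1 := i1.hasSum_range_iff.2 h1
  refine H0.add_isCompl ?_ H1
  rw [isCompl_iff, codisjoint_iff, Set.disjoint_left]
  constructor
  · rintro x ⟨y, rfl⟩ ⟨z, hz⟩
    exact hd _ _ hz.symm
  · ext x
    simpa using hc x

theorem hs1 (a b : ℕ) (ha : 0 < a) (hb : 0 < b) :
    HasSum (fun s : ℤ => (X ^ (ex a b s) : S)) (Th 1 a b) := by
  simpa using hasSum_Th 1 a b ha hb

theorem hs1E (a b : ℕ) (ha : 0 < a) (hb : 0 < b) :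
    HasSum (fun s : ℤ => (X ^ (3 * ex a b s) : S)) (E (Th 1 a b)) := by
  have := hasSum_E (hs1 a b ha hb)
  simp only [map_pow] at this
  convert this using 2 with s
  rw [pow_mul]; congr 1; unfold E; rw [expand_X]

theorem E_X_pow (n : ℕ) : E (X^n) = X^(3*n) := by
  rw [E_eq, ← pow_mul, mul_comm]

theorem hs1EE (a b : ℕ) (ha : 0 < a) (hb : 0 < b) :
    HasSum (fun s : ℤ => (X ^ (9 * ex a b s) : S)) (E (E (Th 1 a b))) := by
  have := hasSum_E (hs1E a b ha hb)
  simp only [E_X_pow, ← mul_assoc] at this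
  exact this

theorem psi_dis : Th 1 1 3 = E (Th 1 1 2) + X * E (E (Th 1 1 3)) := by
  apply (hs1 1 3 (by norm_num) (by norm_num)).unique
  refine hasSum_two (fun u => if u % 2 = 0 then 3*(u/2) else 2 - 3*((u+1)/2)) (fun u => -3*u+1) ?_ ?_ ?_ ?_ ?_ ?_
  · intro x y h
    simp only at h
    split_ifs at h <;> omega
  · intro x y h
    have h' : -3*x+1 = -3*y+1 := h
    omega
  · intro x y h
    split_ifs at h <;> omega
  · intro z
    have : z % 3 = 0 ∨ z % 3 = 1 ∨ z % 3 = 2 := by omega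
    rcases this with h | h | h
    · refine Or.inl ⟨2*(z/3), ?_⟩
      split_ifs <;> omega
    · exact Or.inr ⟨-(z/3), by omega⟩
    · refine Or.inl ⟨-2*(z/3)-1, ?_⟩
      split_ifs <;> omega
  · convert hs1E 1 2 (by norm_num) (by norm_num) using 3 with u
    have h1 := two_ex 1 2 u
    split_ifs with h
    · obtain ⟨t, rfl⟩ : ∃ t, u = 2*t := ⟨u/2, by omega⟩
      have h2 := two_ex 1 3 (3*(2*t/2))
      rw [show 2*t/2 = t by omega] at *
      zify; push_cast at *; linarith
    · obtain ⟨t, rfl⟩ : ∃ t, u = 2*t-1 := ⟨(u+1)/2, by omega⟩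
      have h2 := two_ex 1 3 (2 - 3*((2*t-1+1)/2))
      rw [show (2*t-1+1)/2 = t by omega] at *
      zify; push_cast at *; linarith
  · have := (hs1EE 1 3 (by norm_num) (by norm_num)).mul_left (X:S)
    refine Eq.mpr (congrArg (fun g => HasSum g _) (funext fun u => ?_)) this
    rw [← pow_succ']; congr 1
    have h1 := two_ex 1 3 u
    have h2 := two_ex 1 3 (-3*u+1)
    zify; push_cast at *; linarith

theorem phi_dis : Th 1 1 1 = E (E (Th 1 1 1)) + X * E (Th 1 1 5) + X * E (Th 1 1 5) := by
  apply (hs1 1 1 (by norm_num) (by norm_num)).unique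
  apply hasSum_mod3
  · convert (hs1EE 1 1 (by norm_num) (by norm_num)) using 2 with u
    congr 1
    have h1 := two_ex 1 1 u
    have h2 := two_ex 1 1 (3*u)
    zify; push_cast at *; linarith
  · have := ((Equiv.neg ℤ).hasSum_iff.2 ((hs1E 1 5 (by norm_num) (by norm_num)).mul_left X))
    refine Eq.mpr (congrArg (fun g => HasSum g _) (funext fun u => ?_)) this
    simp only [Function.comp]
    rw [← pow_succ']; congr 1
    have h1 := two_ex 1 5 (-u)
    have h2 := two_ex 1 1 (3*u+1)
    simp only [Equiv.neg_apply]
    zify; push_cast at *; linarith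
  · have := ((Equiv.addRight (1:ℤ)).hasSum_iff.2 ((hs1E 1 5 (by norm_num) (by norm_num)).mul_left X))
    refine Eq.mpr (congrArg (fun g => HasSum g _) (funext fun u => ?_)) this
    simp only [Function.comp]
    rw [← pow_succ']; congr 1
    have h1 := two_ex 1 5 (u+1)
    have h2 := two_ex 1 1 (3*u+2)
    simp only [Equiv.coe_addRight]
    zify; push_cast at *; linarith

theorem U1_phi2 : U 1 (Th (-1) 2 2) = 0 := by
  ext n
  rw [coeff_U, Th, coeff_mk]
  simp only [map_zero]
  refine Finset.sum_eq_zero fun s _ => ?_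
  rw [if_neg]
  intro h
  have h1 := two_ex 2 2 s
  rw [h] at h1
  have h2 : s % 3 = 0 ∨ s % 3 = 1 ∨ s % 3 = 2 := by omega
  have h3 : (3*n+1 : ℤ) = 2 * (s*s) := by push_cast at h1; linarith
  have h4 : (s*s) % 3 = 0 ∨ (s*s) % 3 = 1 := by
    rcases h2 with h | h | h <;> simp [Int.mul_emod, h]
  omega

theorem rescale_Th (a b : ℕ) (h : ∀ s, Even (ex a b s + s.natAbs)) :
    rescale (-1) (Th 1 a b) = Th (-1) a b := by
  ext n
  rw [coeff_rescale, Th, Th, coeff_mk, coeff_mk, Finset.mul_sum]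
  refine Finset.sum_congr rfl fun s _ => ?_
  split_ifs with h'
  · have := h s
    rw [h'] at this
    have h3 : ((-1 : ZMod 3))^n * (-1)^s.natAbs = 1 := by rw [← pow_add]; exact this.neg_one_pow
    have h4 : ((-1 : ZMod 3))^s.natAbs * (-1)^s.natAbs = 1 := by rw [← pow_add]; exact Even.neg_one_pow ⟨_, rfl⟩
    rw [one_pow, mul_one]
    calc ((-1 : ZMod 3))^n = (-1)^n * ((-1)^s.natAbs * (-1)^s.natAbs) := by rw [h4, mul_one]
      _ = _ := by rw [← mul_assoc, h3, one_mul]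
  · simp

theorem R_psi : rescale (-1) (Th 1 1 3) = Th (-1) 1 3 := by
  apply rescale_Th
  intro s
  have h := two_ex 1 3 s
  have h2 : (ex 1 3 s : ℤ) = 2*(s*s) - s := by push_cast at h; linarith
  have : (ex 1 3 s + s.natAbs) % 2 = 0 := by omega
  exact Nat.even_iff.2 this

theorem R_phi : rescale (-1) (Th 1 1 1) = Th (-1) 1 1 := by
  apply rescale_Th
  intro s
  have h := two_ex 1 1 s
  have h2 : (ex 1 1 s : ℤ) = (s*s) := by push_cast at h; linarith
  have h3 : s * s % 2 = s % 2 := by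
    have : s % 2 = 0 ∨ s % 2 = 1 := by omega
    rcases this with h | h <;> simp [Int.mul_emod, h]
  have : (ex 1 1 s + s.natAbs) % 2 = 0 := by omega
  exact Nat.even_iff.2 this

theorem euler (a : ℕ) (ha : 0 < a) : P 1 a a * P (-1) a (2*a) = 1 := by
  have h1 := P_mul_neg a a ha
  have h2 := P_split2 (-1) a a ha
  rw [← two_mul a] at h2
  apply mul_right_cancel₀ (P_ne_zero (-1) (2*a) (2*a) (by omega) (by omega))
  rw [one_mul, mul_assoc, h2, h1]

theorem j_psi (ε : ZMod 3) (hε : ε * ε = 1) : Th ε 1 3 = P ε 1 2 * P (-1) 4 4 := by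
  rw [← jtp ε hε 1 3 (by norm_num) (by norm_num), ← P_split2 ε 1 2 (by norm_num)]

theorem j_phi (ε : ZMod 3) (hε : ε * ε = 1) : Th ε 1 1 = P ε 1 2 * P ε 1 2 * P (-1) 2 2 := by
  rw [← jtp ε hε 1 1 (by norm_num) (by norm_num)]

theorem j_phi2 : Th (-1) 2 2 = P (-1) 2 4 * P (-1) 2 4 * P (-1) 4 4 := by
  rw [← jtp (-1) (by norm_num) 2 2 (by norm_num) (by norm_num)]

theorem j_A : Th 1 1 2 * P 1 3 3 = P 1 1 1 * P (-1) 3 3 := by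
  rw [← jtp 1 (by norm_num) 1 2 (by norm_num) (by norm_num), ← P_split3 1 1 1 (by norm_num)]
  norm_num; ring

theorem j_Om : Th 1 1 5 * P 1 3 6 = P 1 1 2 * P (-1) 6 6 := by
  rw [← jtp 1 (by norm_num) 1 5 (by norm_num) (by norm_num), ← P_split3 1 1 2 (by norm_num)]
  norm_num; ring

/-- identity (ii) -/
theorem ident2 : Th 1 1 2 * Th (-1) 1 3 = P (-1) 4 4 * E (Th (-1) 1 1) := by
  rw [E_eq, j_phi (-1) (by norm_num), j_psi (-1) (by norm_num), mul_pow, mul_pow, P_cube _ _ _ (by norm_num),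
    P_cube _ _ _ (by norm_num)]
  have h1 := euler 1 (by norm_num)
  have h3 := euler 3 (by norm_num)
  have hs := P_split2 (-1) 3 3 (by norm_num)
  have hA := j_A
  norm_num at *
  set A := Th 1 1 2
  calc A * (P (-1) 1 2 * P (-1) 4 4) = (A * P 1 3 3) * P (-1) 3 6 * (P (-1) 1 2 * P (-1) 4 4) := by
        linear_combination (-(A * (P (-1) 1 2 * P (-1) 4 4))) * h3
    _ = (P 1 1 1 * P (-1) 1 2) * P (-1) 3 3 * P (-1) 3 6 * P (-1) 4 4 := by rw [hA]; ring
    _ = _ := by rw [h1, ← hs]; ring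

/-- identity (iii) -/
theorem ident3 : Th 1 1 3 * Th 1 1 5 * Th 1 1 2 * P 1 3 6 = Th (-1) 2 2 * P (-1) 3 3 * P (-1) 6 6 := by
  have hA := j_A
  have hO := j_Om
  have hψ := j_psi 1 (by norm_num)
  have hφ := j_phi2
  have e2 := euler 2 (by norm_num)
  -- D2 f2 = f4
  have hD2 := P_mul_neg 2 2 (by norm_num)
  have hD := P_split2 1 1 1 (by norm_num)
  have hf2 := P_split2 (-1) 2 2 (by norm_num)
  have hc := P_cube 1 1 1 (by norm_num)
  norm_num at *
  have n1 := P_ne_zero 1 3 3 (by norm_num) (by norm_num)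
  have n2 := P_ne_zero 1 2 2 (by norm_num) (by norm_num)
  apply mul_right_cancel₀ n1
  apply mul_right_cancel₀ n2
  calc Th 1 1 3 * Th 1 1 5 * Th 1 1 2 * P 1 3 6 * P 1 3 3 * P 1 2 2
      = Th 1 1 3 * (Th 1 1 5 * P 1 3 6) * (Th 1 1 2 * P 1 3 3) * P 1 2 2 := by ring
    _ = (P 1 1 2 * P (-1) 4 4) * (P 1 1 2 * P (-1) 6 6) * (P 1 1 1 * P (-1) 3 3) * P 1 2 2 := by rw [hA, hO, hψ]
    _ = (P 1 1 2 * P 1 2 2)^2 * P 1 1 1 * P (-1) 2 2 * P (-1) 6 6 * P (-1) 3 3 := by rw [← hD2]; ring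
    _ = P 1 1 1 ^3 * P (-1) 2 2 * P (-1) 6 6 * P (-1) 3 3 := by rw [hD]; ring
    _ = P 1 3 3 * P (-1) 2 2 * P (-1) 6 6 * P (-1) 3 3 := by rw [hc]
    _ = P 1 3 3 * (P (-1) 2 4 * P (-1) 4 4) * P (-1) 6 6 * P (-1) 3 3 * (P 1 2 2 * P (-1) 2 4) := by rw [hf2, e2]; ring
    _ = _ := by rw [hφ]; ring

theorem U1_van : U 1 (Th 1 1 3 * Th 1 1 5 * Th 1 1 2) = 0 := by
  have h := congrArg (U 1) ident3
  have c1 := P_cube 1 1 2 (by norm_num)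
  have c2 := P_cube (-1) 1 1 (by norm_num)
  have c3 := P_cube (-1) 2 2 (by norm_num)
  norm_num at c1 c2 c3
  rw [← c1, ← c2, ← c3, ← E_eq, ← E_eq, ← E_eq, U1_mul, U1_mul, U1_mul, U1_phi2, zero_mul, zero_mul] at h
  exact (mul_eq_zero.1 h).resolve_right (P_ne_zero _ _ _ (by norm_num) (by norm_num))

theorem psi_ne (ε : ZMod 3) (hε : ε * ε = 1) : Th ε 1 3 ≠ 0 := by
  rw [j_psi ε hε]
  exact mul_ne_zero (P_ne_zero _ _ _ (by norm_num) (by norm_num)) (P_ne_zero _ _ _ (by norm_num) (by norm_num))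

/-- the function C⁺ -/
noncomputable def Cp : S := Th 1 1 1 * Th 1 1 3 ^ 5

theorem Cp_rel : U 1 (U 2 Cp) = Cp := by
  have three : (3 : S) = 0 := by exact_mod_cast CharP.cast_eq_zero S 3
  set ψ := Th 1 1 3 with hψ
  set φ := Th 1 1 1 with hφ
  set A := Th 1 1 2
  set Om := Th 1 1 5
  have d1 : ψ = E A + X * E (E ψ) := psi_dis
  have d2 : φ = E (E φ) + X * E Om + X * E Om := phi_dis
  have h1 : φ * ψ^2 = E (E φ * A^2 + X * (2 * Om * (E ψ)^2)) + X * E (2 * Om * A^2 + 2 * E φ * A * E ψ) +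
      X^2 * E (E φ * (E ψ)^2 + Om * A * E ψ) := by
    have hX : E X = X^3 := E_eq X
    conv_lhs => rw [d1, d2]
    simp only [map_add, map_mul, map_pow, hX, map_ofNat]
    linear_combination (X^2 * E Om * E A * E (E ψ)) * three
  have h2 : U 2 Cp = ψ * E (φ * ψ^2) + (ψ * Om * A) * E ψ := by
    have : Cp = φ * ψ^2 * E ψ := by rw [E_eq, Cp]; ring
    rw [this, U2_mul, h1, U2, ← h1]
    simp only [map_mul, map_pow]; ring
  have h3 : U 1 ψ = E ψ := by
    have : ψ = E A + X * E (E ψ) + X^2 * E 0 := by rw [map_zero, mul_zero, add_zero]; exact d1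
    rw [this, U1, ← this]
  rw [h2, U_add, U1_mul, U1_mul, U1_van, h3, E_eq, Cp]
  ring

theorem Cp_coeff (n : ℕ) : coeff (9*n+5) Cp = coeff n Cp := by
  conv_rhs => rw [← Cp_rel, coeff_U, coeff_U]
  congr 2; ring

theorem main_series (B : S) (hB : B * P (-1) 4 4 ^ 3 = Th 1 1 3) :
    U 2 (U 0 B) = rescale (-1) Cp := by
  have three : (3 : S) = 0 := by exact_mod_cast CharP.cast_eq_zero S 3
  have hR : rescale (-1) Cp = Th (-1) 1 1 * Th (-1) 1 3 ^ 5 := by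
    rw [Cp, map_mul, map_pow, R_phi, R_psi]
  have dm : Th (-1) 1 3 = E (rescale (-1) (Th 1 1 2)) - X * E (E (Th (-1) 1 3)) := by
    have := congrArg (rescale (-1)) psi_dis
    rw [map_add, map_mul, E_eq, E_eq, E_eq, map_pow, map_pow, map_pow, R_psi, rescale_X] at this
    rw [E_eq, E_eq, E_eq]; refine this.trans ?_; simp [sub_eq_add_neg]
  have h0 : U 0 B * P (-1) 4 4 = Th 1 1 2 := by
    have := congrArg (U 0) hB
    rw [← E_eq, U0_mul] at this
    rw [this]
    have d : Th 1 1 3 = E (Th 1 1 2) + X * E (E (Th 1 1 3)) + X^2 * E 0 := by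
      rw [map_zero, mul_zero, add_zero]; exact psi_dis
    rw [d, U0]
  have hne := psi_ne (-1) (by norm_num)
  set ψ := Th (-1) 1 3
  set φ := Th (-1) 1 1
  set A := rescale (-1) (Th 1 1 2)
  have h1 : U 0 B * ψ = E φ := by
    apply mul_left_cancel₀ (P_ne_zero (-1) 4 4 (by norm_num) (by norm_num))
    have := ident2
    rw [← this, ← h0]; ring
  have h2 : U 0 B * E ψ = ψ^2 * E φ := by rw [E_eq ψ, ← h1]; ring
  have h3 : ψ^2 = E (A^2) + X * E (- 2 * A * E ψ) + X^2 * E ((E ψ)^2) := by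
    conv_lhs => rw [dm]
    simp only [map_mul, map_pow, map_neg, map_ofNat]; ring
  have h4 := congrArg (U 2) h2
  rw [U2_mul, U2_mul, h3, U2, E_eq] at h4
  rw [hR]
  apply mul_right_cancel₀ hne
  rw [h4]; ring

theorem main_rec (B : S) (hB : B * P (-1) 4 4 ^ 3 = Th 1 1 3) (n : ℕ) :
    coeff (9*(9*n+5)+6) B = - coeff (9*n+6) B := by
  have key : ∀ n, coeff (9*n+6) B = (-1)^n * coeff n Cp := by
    intro n
    rw [← coeff_rescale, ← main_series B hB, coeff_U, coeff_U]
    congr 2; ring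
  rw [key, key, Cp_coeff]
  have : (-1 : ZMod 3)^(9*n+5) = -(-1)^n := by
    rw [show 9*n+5 = n + (2*(4*n+2)+1) by ring, pow_add, pow_succ, pow_mul]; simp
  rw [this]; ring

end BT


namespace BT

open scoped PowerSeries.WithPiTopology

theorem conv_finite {α β : Type} (w : α → ℕ) (v : β → ℕ) (p : α → Prop) (q : β → Prop)
    (hp : ∀ n, Finite {x : α // w x = n ∧ p x}) (hq : ∀ n, Finite {x : β // v x = n ∧ q x}) (n : ℕ) :
    Finite {x : α × β // w x.1 + v x.2 = n ∧ p x.1 ∧ q x.2} ∧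
    Nat.card {x : α × β // w x.1 + v x.2 = n ∧ p x.1 ∧ q x.2} =
      ∑ a ∈ Finset.HasAntidiagonal.antidiagonal n,
        Nat.card {x : α // w x = a.1 ∧ p x} * Nat.card {x : β // v x = a.2 ∧ q x} := by
  let e : {x : α × β // w x.1 + v x.2 = n ∧ p x.1 ∧ q x.2} ≃
      Σ a : Finset.HasAntidiagonal.antidiagonal n, {x : α // w x = a.1.1 ∧ p x} × {x : β // v x = a.1.2 ∧ q x} :=
    { toFun := fun x => ⟨⟨(w x.1.1, v x.1.2), by simpa using x.2.1⟩, ⟨x.1.1, rfl, x.2.2.1⟩, ⟨x.1.2, rfl, x.2.2.2⟩⟩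
      invFun := fun y => ⟨(y.2.1.1, y.2.2.1), by
        have := y.1.2
        rw [Finset.HasAntidiagonal.mem_antidiagonal] at this
        simp only [y.2.1.2.1, y.2.2.2.1]; exact this, y.2.1.2.2, y.2.2.2.2⟩
      left_inv := fun x => rfl
      right_inv := by
        rintro ⟨⟨⟨a, b⟩, h⟩, ⟨x, hx1, hx2⟩, ⟨y, hy1, hy2⟩⟩
        simp only at hx1 hy1
        subst hx1 hy1
        rfl }
  constructor
  · exact Finite.of_equiv _ e.symm
  · rw [Nat.card_congr e, Nat.card_sigma]
    simp only [Nat.card_prod]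
    exact Finset.sum_coe_sort (Finset.HasAntidiagonal.antidiagonal n)
      (fun a => Nat.card {x : α // w x = a.1 ∧ p x} * Nat.card {x : β // v x = a.2 ∧ q x})

def partEquiv (n : ℕ) (p : Multiset ℕ → Prop) (hp : ∀ s, p s → ∀ x ∈ s, 0 < x) :
    {s : Multiset ℕ // s.sum = n ∧ p s} ≃ {x : n.Partition // p x.parts} where
  toFun s := ⟨⟨s.1, fun {i} hi => hp _ s.2.2 i hi, s.2.1⟩, s.2.2⟩
  invFun x := ⟨x.1.parts, x.1.parts_sum, x.2⟩
  left_inv s := rfl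
  right_inv x := rfl

def pO (s : Multiset ℕ) : Prop := s.Nodup ∧ ∀ x ∈ s, Odd x
def p4 (s : Multiset ℕ) : Prop := ∀ x ∈ s, 0 < x ∧ 4 ∣ x

theorem pO_pos (s) (h : pO s) : ∀ x ∈ s, 0 < x := fun x hx => (h.2 x hx).pos
theorem p4_pos (s) (h : p4 s) : ∀ x ∈ s, 0 < x := fun x hx => (h x hx).1

noncomputable def cO (n : ℕ) : ℕ := Nat.card {s : Multiset ℕ // s.sum = n ∧ pO s}
noncomputable def c4 (n : ℕ) : ℕ := Nat.card {s : Multiset ℕ // s.sum = n ∧ p4 s}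

theorem finO (n : ℕ) : Finite {s : Multiset ℕ // s.sum = n ∧ pO s} :=
  Finite.of_equiv _ (partEquiv n pO pO_pos).symm
theorem fin4 (n : ℕ) : Finite {s : Multiset ℕ // s.sum = n ∧ p4 s} :=
  Finite.of_equiv _ (partEquiv n p4 p4_pos).symm

theorem bT_eq (n : ℕ) : bTriple n = ∑ a ∈ Finset.HasAntidiagonal.antidiagonal n,
    cO a.1 * ∑ b ∈ Finset.HasAntidiagonal.antidiagonal a.2, c4 b.1 * c4 b.2 := by
  have h1 := fun n => conv_finite Multiset.sum Multiset.sum p4 p4 fin4 fin4 n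
  have h2 := (conv_finite Multiset.sum (fun y : Multiset ℕ × Multiset ℕ => y.1.sum + y.2.sum) pO
    (fun y => p4 y.1 ∧ p4 y.2) finO (fun n => (h1 n).1) n).2
  simp only [(h1 _).2] at h2
  rw [bTriple]
  refine Eq.trans ?_ h2
  apply Nat.card_congr
  refine Equiv.subtypeEquivRight fun x => ?_
  simp only [pO, p4, add_assoc, and_assoc]

theorem B_eq : (PowerSeries.mk fun n => (bTriple n : ZMod 3)) =
    (PowerSeries.mk fun n => (cO n : ZMod 3)) * ((PowerSeries.mk fun n => (c4 n : ZMod 3)) * (PowerSeries.mk fun n => (c4 n : ZMod 3))) := by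
  ext n
  simp only [coeff_mk, coeff_mul, bT_eq]
  push_cast; rfl

theorem GO_eq : (PowerSeries.mk fun n => (cO n : ZMod 3)) = P 1 1 2 := by
  classical
  let f : ℕ → ℕ → ZMod 3 := fun i c => if Odd i ∧ c < 2 then 1 else 0
  have h := Nat.Partition.hasProd_genFun f
  have e1 : Nat.Partition.genFun f = PowerSeries.mk fun n => (cO n : ZMod 3) := by
    ext n
    rw [Nat.Partition.coeff_genFun, coeff_mk, cO, Nat.card_congr (partEquiv n pO pO_pos), Nat.card_eq_fintype_card,
      Fintype.card_subtype, Finset.card_filter]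
    push_cast
    refine Finset.sum_congr rfl fun x _ => ?_
    simp only [f, Finsupp.prod, Finset.prod_boole]
    congr 1
    simp only [pO, Multiset.nodup_iff_count_le_one, eq_iff_iff]
    simp only [Multiset.toFinsupp_support, Multiset.mem_toFinset, Multiset.toFinsupp_apply]
    constructor
    · intro h
      refine ⟨fun a => ?_, fun a ha => (h a ha).1⟩
      by_cases ha : a ∈ x.parts
      · have := (h a ha).2; omega
      · simp [Multiset.count_eq_zero_of_notMem ha]
    · intro h i hi
      have := h.1 i
      exact ⟨h.2 i hi, by omega⟩
  rw [← e1]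
  apply h.unique
  have t : ∀ i : ℕ, (1 + ∑' j, f (i + 1) (j + 1) • (X : S) ^ ((i + 1) * (j + 1))) = if Odd (i+1) then 1 + X^(i+1) else 1 := by
    intro i
    rw [tsum_eq_single 0]
    · by_cases hi : Odd (i+1) <;> simp [f, hi]
    · intro j hj
      have : ¬ (j + 1 < 2) := by omega
      simp [f, hj]
  simp only [t]
  rw [← mul_one (P 1 1 2)]
  apply HasProd.even_mul_odd
  · refine Eq.mpr (congrArg (fun g => HasProd g _) (funext fun k => ?_)) (mult 1 1 2 (by norm_num)).hasProd
    rw [if_pos ⟨k, rfl⟩]; simp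
  · refine Eq.mpr (congrArg (fun g => HasProd g _) (funext fun k => ?_)) hasProd_one
    rw [if_neg]
    rw [Nat.not_odd_iff_even]; exact ⟨k+1, by ring⟩

theorem G4_eq : (PowerSeries.mk fun n => (c4 n : ZMod 3)) * P (-1) 4 4 = 1 := by
  classical
  have h := Nat.Partition.hasProd_powerSeriesMk_card_restricted (ZMod 3) (fun i => 4 ∣ i)
  have e1 : (PowerSeries.mk fun n => ((Nat.Partition.restricted n (fun i => 4 ∣ i)).card : ZMod 3))
      = PowerSeries.mk fun n => (c4 n : ZMod 3) := by
    ext n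
    rw [coeff_mk, coeff_mk, c4, Nat.card_congr (partEquiv n p4 p4_pos), Nat.card_eq_fintype_card,
      Fintype.card_subtype, Nat.Partition.restricted]
    congr 2
    ext x
    simp only [Finset.mem_filter, Finset.mem_univ, true_and]
    exact ⟨fun h i hi => ⟨x.parts_pos hi, h i hi⟩, fun h i hi => (h i hi).2⟩
  rw [e1] at h
  have h2 : HasProd (fun i : ℕ => if 4 ∣ i + 1 then (1 - X^(i+1) : S) else 1) (P (-1) 4 4) := by
    have inj : Function.Injective (fun k : ℕ => 4*k+3) := fun x y h => by simpa using h
    rw [← inj.hasProd_iff]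
    · refine Eq.mpr (congrArg (fun g => HasProd g _) (funext fun k => ?_)) (mult (-1) 4 4 (by norm_num)).hasProd
      simp only [Function.comp]
      rw [if_pos ⟨k+1, by ring⟩]; simp; ring
    · intro x hx
      rw [if_neg]
      intro hd
      exact hx ⟨x/4, by simp only; omega⟩
  refine (h.mul h2).unique ?_
  refine Eq.mpr (congrArg (fun g => HasProd g _) (funext fun i => ?_)) hasProd_one
  split_ifs with hi
  · simp_rw [pow_mul]
    exact WithPiTopology.tsum_pow_mul_one_sub_of_constantCoeff_eq_zero (by simp)
  · simp

theorem hB : (PowerSeries.mk fun n => (bTriple n : ZMod 3)) * P (-1) 4 4 ^ 3 = Th 1 1 3 := by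
  rw [B_eq, GO_eq, j_psi 1 (by norm_num)]
  have h := G4_eq
  set G := (PowerSeries.mk fun n => (c4 n : ZMod 3))
  calc _ = P 1 1 2 * (G * P (-1) 4 4) * (G * P (-1) 4 4) * P (-1) 4 4 := by ring
    _ = _ := by rw [h]; ring

theorem b_rec (n : ℕ) : (bTriple (9*(9*n+5)+6) : ZMod 3) = - bTriple (9*n+6) := by
  have := main_rec _ hB n
  simpa only [coeff_mk] using this

end BT


/-- `b(3^(2(k+1)) n + (5 ⬝ 3^(2(k+1)) + 3)/8) ≡ (-1)^k b(9n+6) (mod 3)`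
for all `n, k ≥ 0`. -/
theorem bTriple_internal_congruence (n k : ℕ) :
    (bTriple (3 ^ (2 * (k + 1)) * n + (5 * 3 ^ (2 * (k + 1)) + 3) / 8) : ℤ) ≡
      (-1) ^ k * (bTriple (9 * n + 6) : ℤ) [ZMOD 3] := by
  have key : ∀ k : ℕ, ∃ M : ℕ, 8 * M + 5 = 9 ^ k * (8 * n + 5) ∧
      (bTriple (9 * M + 6) : ZMod 3) = (-1) ^ k * bTriple (9 * n + 6) := by
    intro k
    induction k with
    | zero => exact ⟨n, by simp, by simp⟩
    | succ k ih =>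
      obtain ⟨M, h1, h2⟩ := ih
      refine ⟨9 * M + 5, ?_, ?_⟩
      · rw [pow_succ]; linarith
      · rw [BT.b_rec, h2, pow_succ]; ring
  obtain ⟨M, h1, h2⟩ := key k
  have e : 3 ^ (2 * (k + 1)) * n + (5 * 3 ^ (2 * (k + 1)) + 3) / 8 = 9 * M + 6 := by
    have h3 : 3 ^ (2 * (k + 1)) = 9 * 9 ^ k := by rw [pow_mul, pow_succ]; norm_num [mul_comm]
    rw [h3]
    have h4 : 9 ^ k * (8 * n + 5) = 8 * (9 ^ k * n) + 5 * 9 ^ k := by ring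
    have h5 : 9 * 9 ^ k * n = 9 * (9 ^ k * n) := by ring
    rw [h5]
    omega
  rw [e]
  have := (ZMod.intCast_eq_intCast_iff (bTriple (9 * M + 6) : ℤ) ((-1) ^ k * (bTriple (9 * n + 6) : ℤ)) 3).1
    (by push_cast; exact h2)
  exact_mod_cast this
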